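/- Let X be a compact, locally connected metric space such that the Lipschitz deformation principle L(X) holds, and let {U_α}_{α∈A} be a finite open cover of X. For every increasing continuous function χ₀ : [0,∞) → [0,∞) with χ₀(0)=0 there exist δ₀ > 0 and an increasing continuous function χ : [0,∞) → [0,∞) with χ(0)=0, depending only on X, the cover {U_α}, and χ₀, such that the following holds for every 0 < δ < δ₀: if X̃ is a compact, χ₀-connected metric space covered by open sets {Ũ_α}_{α∈A}, θ : X → X̃ is a δ-approximation, and for each α ∈ A, φ_α : U_α → Ũ_α is a Lipschitz isomorphism with d(φ_α(x), θ(x)) < δ for all x ∈ U_α, then there exists a bi-Lipschitz homeomorphism θ′ : X → X̃ with d(θ′(x), θ(x)) ≤ χ(δ) for all x ∈ X. -/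

import Mathlib

open Topology Metric Set

universe u v

section Defs

variable {X Y : Type*}

/-- A (local) Lipschitz embedding: `f` is injective, locally Lipschitz, and its inverse
`f ⁻¹ : f(X) → X` is locally Lipschitz. -/
def IsLipschitzEmbedding [MetricSpace X] [MetricSpace Y] (f : X → Y) : Prop :=
  Function.Injective f ∧ LocallyLipschitz f ∧
    ∃ g : Set.range f → X, Function.LeftInverse g (Set.rangeFactorization f) ∧ LocallyLipschitz g

/-- An open Lipschitz embedding: a Lipschitz embedding with open image. -/
def IsOpenLipschitzEmbedding [MetricSpace X] [MetricSpace Y] (f : X → Y) : Prop :=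
  IsLipschitzEmbedding f ∧ IsOpen (Set.range f)

/-- A Lipschitz isomorphism: a surjective Lipschitz embedding. -/
def IsLipschitzIso [MetricSpace X] [MetricSpace Y] (f : X → Y) : Prop :=
  IsLipschitzEmbedding f ∧ Function.Surjective f

/-- The inclusion of a subset, as a continuous map. -/
def inclCM [TopologicalSpace X] (U : Set X) : C(↥U, X) :=
  ⟨Subtype.val, continuous_subtype_val⟩

/-- The data of a deformation rule `h ↦ D h` for the principle `L(X; C; U)`:
the rule is continuous near the inclusion, sends the inclusion to the identity, and sends any
open Lipschitz embedding `h` in the neighbourhood `N` of the inclusion to a Lipschitz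
isomorphism of `X` agreeing with `h` on `C` and with the inclusion outside `U`. -/
def DeformationData [MetricSpace X] (U C : Set X) (N : Set C(↥U, X))
    (D : C(↥U, X) → C(X, X)) : Prop :=
  ContinuousOn D {h | h ∈ N ∧ IsOpenLipschitzEmbedding (⇑h : ↥U → X)} ∧
  D (inclCM U) = ContinuousMap.id X ∧
  ∀ h ∈ N, IsOpenLipschitzEmbedding (⇑h : ↥U → X) →
    IsLipschitzIso (⇑(D h) : X → X) ∧
    (∀ x : ↥U, (x : X) ∈ C → D h x = h x) ∧
    (∀ x : X, x ∉ U → D h x = x)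

/-- Sullivan's Lipschitz deformation principle `L(X)`. -/
def LipschitzDeformationPrinciple (X : Type v) [MetricSpace X] : Prop :=
  ∀ U : Set X, IsOpen U → ∀ C : Set X, IsCompact C → C ⊆ U →
    ∃ N ∈ 𝓝 (inclCM U), ∃ D : C(↥U, X) → C(X, X), DeformationData U C N D

end Defs

/-- An increasing continuous function `χ : [0,∞) → [0,∞)` with `χ(0) = 0`. -/
def IsModulus (χ : ℝ → ℝ) : Prop :=
  Continuous χ ∧ Monotone χ ∧ χ 0 = 0 ∧ ∀ x, 0 ≤ χ x

/-- A metric space is `χ₀`-connected if any two points `x, y` can be joined by a curve of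
diameter at most `χ₀ (dist x y)`. -/
def IsChiConnected (χ₀ : ℝ → ℝ) (Y : Type u) [MetricSpace Y] : Prop :=
  ∀ x y : Y, ∃ γ : C(↥(Set.Icc (0:ℝ) 1), Y),
    γ ⟨0, Set.left_mem_Icc.2 zero_le_one⟩ = x ∧
    γ ⟨1, Set.right_mem_Icc.2 zero_le_one⟩ = y ∧
    Metric.diam (Set.range (⇑γ)) ≤ χ₀ (dist x y)

/-- A `δ`-approximation `θ : X → Y`: it distorts distances by less than `δ` and its image is
`δ`-dense. -/
def IsDeltaApprox {X : Type v} {Y : Type u} [MetricSpace X] [MetricSpace Y]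
    (δ : ℝ) (θ : X → Y) : Prop :=
  (∀ x y : X, |dist x y - dist (θ x) (θ y)| < δ) ∧ ∀ z : Y, ∃ x : X, dist z (θ x) ≤ δ

/-- A (globally) bi-Lipschitz homeomorphism. -/
def IsBiLipschitzHomeo {X : Type v} {Y : Type u} [MetricSpace X] [MetricSpace Y]
    (f : X → Y) : Prop :=
  Function.Bijective f ∧ ∃ L : NNReal, LipschitzWith L f ∧ AntilipschitzWith L f

section Helpers

open Filter

/-- `f` is an open, bi-Lipschitz map near `x`. -/
def GoodAt {X Y : Type*} [MetricSpace X] [MetricSpace Y] (f : X → Y) (x : X) : Prop :=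
  (∃ L : ℝ, 0 ≤ L ∧ ∃ t ∈ 𝓝 x, ∀ p ∈ t, ∀ q ∈ t,
    dist (f p) (f q) ≤ L * dist p q ∧ dist p q ≤ L * dist (f p) (f q)) ∧
  𝓝 (f x) ≤ map f (𝓝 x)

variable {X Y Z : Type*} [MetricSpace X] [MetricSpace Y] [MetricSpace Z]

lemma lip_of_real {f : X → Y} {L : ℝ} (hL : 0 ≤ L) {t : Set X}
    (h : ∀ p ∈ t, ∀ q ∈ t, dist (f p) (f q) ≤ L * dist p q) :
    LipschitzOnWith ⟨L, hL⟩ f t :=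
  LipschitzOnWith.of_dist_le_mul h

lemma GoodAt.continuousAt {f : X → Y} {x : X} (h : GoodAt f x) : ContinuousAt f x := by
  obtain ⟨⟨L, hL, t, ht, h1⟩, -⟩ := h
  exact (lip_of_real hL (fun p hp q hq => (h1 p hp q hq).1)).continuousOn.continuousAt ht

lemma GoodAt.congr {f g : X → Y} {x : X} (h : GoodAt f x) (hfg : f =ᶠ[𝓝 x] g) : GoodAt g x := by
  obtain ⟨⟨L, hL, t, ht, h1⟩, h2⟩ := h
  refine ⟨⟨L, hL, t ∩ {y | f y = g y}, inter_mem ht hfg, ?_⟩, ?_⟩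
  · rintro p ⟨hp, hp'⟩ q ⟨hq, hq'⟩
    change f p = g p at hp'
    change f q = g q at hq'
    rw [← hp', ← hq']
    exact h1 p hp q hq
  · rw [← hfg.eq_of_nhds, ← map_congr hfg]
    exact h2

lemma GoodAt.comp {f : X → Y} {g : Y → Z} {x : X} (hg : GoodAt g (f x)) (hf : GoodAt f x) :
    GoodAt (fun y => g (f y)) x := by
  have hc := hf.continuousAt
  obtain ⟨⟨L, hL, t, ht, h1⟩, h2⟩ := hf
  obtain ⟨⟨M, hM, s, hs, h3⟩, h4⟩ := hg
  refine ⟨⟨L * M, by positivity, t ∩ f ⁻¹' s, inter_mem ht (hc hs), ?_⟩, ?_⟩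
  · rintro p ⟨hp, hp'⟩ q ⟨hq, hq'⟩
    have a := h1 p hp q hq
    have b := h3 _ hp' _ hq'
    constructor
    · nlinarith [mul_le_mul_of_nonneg_left a.1 hM]
    · nlinarith [mul_le_mul_of_nonneg_left b.2 hL]
  · calc 𝓝 (g (f x)) ≤ map g (𝓝 (f x)) := h4
      _ ≤ map g (map f (𝓝 x)) := map_mono h2
      _ = _ := by rw [Filter.map_map]; rfl

lemma GoodAt.inv {f : X → Y} {g : Y → X} {U : Set X} (hU : IsOpen U) {x : X} (hx : x ∈ U)
    (hg : ∀ u ∈ U, g (f u) = u) (hf : GoodAt f x) : GoodAt g (f x) := by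
  have hc := hf.continuousAt
  obtain ⟨⟨L, hL, t, ht, h1⟩, h2⟩ := hf
  refine ⟨⟨L, hL, f '' (t ∩ U), h2 (image_mem_map (inter_mem ht (hU.mem_nhds hx))), ?_⟩, ?_⟩
  · rintro _ ⟨p, ⟨hp, hp'⟩, rfl⟩ _ ⟨q, ⟨hq, hq'⟩, rfl⟩
    rw [hg p hp', hg q hq']
    exact (h1 p hp q hq).symm
  · rw [hg x hx]
    intro s hs
    have : f ⁻¹' (g ⁻¹' s) ∈ 𝓝 x := hc hs
    filter_upwards [this, hU.mem_nhds hx] with u hu hu'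
    simpa [hg u hu'] using hu

lemma GoodAt.id (x : X) : GoodAt (fun y : X => y) x := by
  refine ⟨⟨1, zero_le_one, univ, univ_mem, by simp⟩, ?_⟩
  simp

lemma goodAt_of_iso {f : X → Y} (h : IsLipschitzIso f) (x : X) : GoodAt f x := by
  obtain ⟨⟨hi, hl, g, hg, hgl⟩, hs⟩ := h
  have hfc : Continuous (rangeFactorization f) :=
    hl.continuous.subtype_mk _
  obtain ⟨K, t, ht, hK⟩ := hl x
  obtain ⟨M, s, hs', hM⟩ := hgl (rangeFactorization f x)
  refine ⟨⟨max K M, by positivity, t ∩ rangeFactorization f ⁻¹' s,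
    inter_mem ht (hfc.continuousAt hs'), ?_⟩, ?_⟩
  · rintro p ⟨hp, hp'⟩ q ⟨hq, hq'⟩
    constructor
    · refine (hK.dist_le_mul p hp q hq).trans ?_
      gcongr
      exact le_max_left _ _
    · have := hM.dist_le_mul _ hp' _ hq'
      rw [hg p, hg q] at this
      refine this.trans ?_
      change (M : ℝ) * dist (f p) (f q) ≤ _
      gcongr
      exact le_max_right _ _
  · intro u hu
    let k : Y → X := fun y => g ⟨y, hs y⟩
    have hk : Continuous k := hgl.continuous.comp (continuous_id.subtype_mk _)
    have hkf : ∀ x, k (f x) = x := fun x => hg x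
    have hfk : ∀ y, f (k y) = y := by
      intro y
      obtain ⟨x, rfl⟩ := hs y
      rw [hkf]
    have hu' : f ⁻¹' u ∈ 𝓝 (k (f x)) := by rw [hkf]; exact hu
    have := hk.continuousAt hu'
    filter_upwards [this] with y hy
    simpa [hfk] using hy

lemma goodAt_val {U : Set X} (hU : IsOpen U) (u : U) : GoodAt (Subtype.val : U → X) u := by
  refine ⟨⟨1, zero_le_one, univ, univ_mem, ?_⟩, ?_⟩
  · intro p _ q _
    simp [Subtype.dist_eq]
  · rw [hU.isOpenEmbedding_subtypeVal.map_nhds_eq]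

lemma goodAt_extend {U : Set X} (hU : IsOpen U) {T : Set Y} (hT : IsOpen T) {f : U → T}
    (hf : IsLipschitzIso f) {F : X → Y} (hF : ∀ u : U, F u = f u) (u : U) : GoodAt F u := by
  have h1 : GoodAt (fun v : U => F v) u :=
    (GoodAt.comp (goodAt_val hT (f u)) (goodAt_of_iso hf u)).congr
      (Eventually.of_forall fun v => (hF v).symm)
  obtain ⟨⟨L, hL, t, ht, h1⟩, h2⟩ := h1
  have hm : map (Subtype.val : U → X) (𝓝 u) = 𝓝 (u : X) :=
    hU.isOpenEmbedding_subtypeVal.map_nhds_eq u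
  refine ⟨⟨L, hL, Subtype.val '' t, ?_, ?_⟩, ?_⟩
  · rw [← hm]; exact image_mem_map ht
  · rintro _ ⟨p, hp, rfl⟩ _ ⟨q, hq, rfl⟩
    exact h1 p hp q hq
  · rw [← hm, Filter.map_map]; exact h2

lemma isOpen_image_of_good {f : X → Y} {W : Set X} (hW : IsOpen W) (hg : ∀ x ∈ W, GoodAt f x) :
    IsOpen (f '' W) := by
  rw [isOpen_iff_mem_nhds]
  rintro _ ⟨x, hx, rfl⟩
  exact (hg x hx).2 (image_mem_map (hW.mem_nhds hx))

lemma isOpenLip_of_good {f : X → Y} {W : Set X} (hW : IsOpen W) (hi : InjOn f W)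
    (hg : ∀ x ∈ W, GoodAt f x) {H : W → Y} (hH : ∀ w : W, H w = f w) :
    IsOpenLipschitzEmbedding H := by
  have hHi : Function.Injective H := by
    intro a b hab
    rw [hH, hH] at hab
    exact Subtype.ext (hi a.2 b.2 hab)
  have hr : range H = f '' W := by
    ext y; constructor
    · rintro ⟨w, rfl⟩; exact ⟨w, w.2, (hH w).symm⟩
    · rintro ⟨w, hw, rfl⟩; exact ⟨⟨w, hw⟩, hH _⟩
  obtain ⟨g, hgH⟩ : ∃ g : range H → W, ∀ y, H (g y) = y :=
    ⟨fun y => y.2.choose, fun y => y.2.choose_spec⟩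
  refine ⟨⟨hHi, ?_, g, ?_, ?_⟩, ?_⟩
  · intro w
    obtain ⟨⟨L, hL, t, ht, h1⟩, h2⟩ := hg w w.2
    refine ⟨⟨L, hL⟩, Subtype.val ⁻¹' t, continuous_subtype_val.continuousAt ht,
      lip_of_real hL ?_⟩
    intro p hp q hq
    rw [hH, hH]
    exact (h1 p hp q hq).1
  · intro w
    exact hHi (hgH _)
  · rintro ⟨_, w, rfl⟩
    obtain ⟨⟨L, hL, t, ht, h1⟩, h2⟩ := hg w w.2
    have hn : f '' (t ∩ W) ∈ 𝓝 (H w) := by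
      rw [hH]; exact h2 (image_mem_map (inter_mem ht (hW.mem_nhds w.2)))
    refine ⟨⟨L, hL⟩, Subtype.val ⁻¹' (f '' (t ∩ W)), continuous_subtype_val.continuousAt hn,
      lip_of_real hL ?_⟩
    rintro y ⟨a, ⟨ha, ha'⟩, hya⟩ z ⟨b, ⟨hb, hb'⟩, hzb⟩
    have hpa' : (g y : X) = a := hi (g y).2 ha' (by rw [← hH, hgH, hya])
    have hqb' : (g z : X) = b := hi (g z).2 hb' (by rw [← hH, hgH, hzb])
    have := (h1 a ha b hb).2
    rw [hya, hzb, ← hpa', ← hqb'] at this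
    exact this
  · rw [hr]; exact isOpen_image_of_good hW hg

lemma lip_of_good [CompactSpace X] {k : X → Y} (hk : ∀ a, GoodAt k a) :
    ∃ K, LipschitzWith K k := by
  have : LocallyLipschitzOn univ k := by
    intro x _
    obtain ⟨⟨L, hL, t, ht, h1⟩, h2⟩ := hk x
    exact ⟨⟨L, hL⟩, t, mem_nhdsWithin_of_mem_nhds ht, lip_of_real hL
      fun p hp q hq => (h1 p hp q hq).1⟩
  obtain ⟨K, hK⟩ := this.exists_lipschitzOnWith_of_compact isCompact_univ
  exact ⟨K, lipschitzOnWith_univ.1 hK⟩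

lemma biLip_of_good [CompactSpace X] [Nonempty X] [PreconnectedSpace Y] {f : X → Y}
    (hi : Function.Injective f)
    (hg : ∀ x, GoodAt f x) :
    IsBiLipschitzHomeo f := by
  have hc : Continuous f := continuous_iff_continuousAt.2 fun x => (hg x).continuousAt
  have hs : Function.Surjective f := by
    rw [← range_eq_univ]
    refine IsClopen.eq_univ ⟨(isCompact_range hc).isClosed, ?_⟩ (range_nonempty f)
    rw [← image_univ]
    exact isOpen_image_of_good isOpen_univ (fun x _ => hg x)
  let g := (Equiv.ofBijective f ⟨hi, hs⟩).symm
  have hgf : ∀ x, g (f x) = x := fun x => (Equiv.ofBijective f ⟨hi, hs⟩).symm_apply_apply x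
  have : CompactSpace Y := ⟨by rw [← range_eq_univ.2 hs]; exact isCompact_range hc⟩
  obtain ⟨K, hK⟩ := lip_of_good hg
  obtain ⟨M, hM⟩ : ∃ M, LipschitzWith M g := lip_of_good (k := g) (by
    intro y
    obtain ⟨x, rfl⟩ := hs y
    exact (hg x).inv isOpen_univ (mem_univ x) (fun u _ => hgf u))
  refine ⟨⟨hi, hs⟩, max K M, hK.weaken (le_max_left _ _), ?_⟩
  exact (hM.weaken (le_max_right K M)).to_rightInverse hgf

/-- The assumptions on the target space. -/
def Sit {X : Type u} [MetricSpace X] {ι : Type} (U : ι → Set X) (χ₀ : ℝ → ℝ) (δ : ℝ)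
    (Y : Type u) [MetricSpace Y] (θ : X → Y) (Φ : ι → X → Y) : Prop :=
  IsChiConnected χ₀ Y ∧ (∀ x y : X, |dist x y - dist (θ x) (θ y)| < δ) ∧
  (∀ i, InjOn (Φ i) (U i)) ∧ (∀ i, ∀ x ∈ U i, GoodAt (Φ i) x) ∧
  (∀ i, ∀ x ∈ U i, dist (Φ i x) (θ x) < δ)

lemma dist_lt_of_approx {θ : X → Y} {δ : ℝ} (h : ∀ x y : X, |dist x y - dist (θ x) (θ y)| < δ)
    (x y : X) : dist x y < dist (θ x) (θ y) + δ := by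
  have := (abs_lt.1 (h x y)).2
  linarith

lemma dist_lt_of_approx' {θ : X → Y} {δ : ℝ} (h : ∀ x y : X, |dist x y - dist (θ x) (θ y)| < δ)
    (x y : X) : dist (θ x) (θ y) < dist x y + δ := by
  have := (abs_lt.1 (h x y)).1
  linarith

lemma curve_mem [CompactSpace X] {Y : Type u} [MetricSpace Y] {χ₀ : ℝ → ℝ}
    (hY : IsChiConnected χ₀ Y) {θ : X → Y} {δ : ℝ}
    (hθ : ∀ x y : X, |dist x y - dist (θ x) (θ y)| < δ) {U : Set X} (hU : IsOpen U)
    {Φ : X → Y} (hΦg : ∀ x ∈ U, GoodAt Φ x) (hΦ : ∀ x ∈ U, dist (Φ x) (θ x) < δ)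
    {A : Set X} {ρ : ℝ} (hA : cthickening ρ A ⊆ U) {x : X} (hx : x ∈ A) (hxU : x ∈ U)
    {y : Y} (hy : χ₀ (dist (Φ x) y) + 3 * δ ≤ ρ) : y ∈ Φ '' U := by
  obtain ⟨γ, h0, h1, hd⟩ := hY (Φ x) y
  have hcont : ContinuousOn Φ U := fun u hu => (hΦg u hu).continuousAt.continuousWithinAt
  have e : γ ⁻¹' (Φ '' U) = γ ⁻¹' (Φ '' (cthickening ρ A)) := by
    apply Subset.antisymm
    · rintro t ⟨u, hu, hut⟩
      refine ⟨u, ?_, hut⟩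
      have hb : Bornology.IsBounded (range γ) := (isCompact_range γ.continuous).isBounded
      have d1 : dist (γ t) (Φ x) ≤ diam (range γ) := by
        rw [← h0]; exact dist_le_diam_of_mem hb (mem_range_self _) (mem_range_self _)
      rw [← hut] at d1
      have d2 := dist_lt_of_approx hθ u x
      have d3 := hΦ u hu
      have d4 := hΦ x hxU
      have d5 := dist_triangle4 (θ u) (Φ u) (Φ x) (θ x)
      rw [dist_comm (θ u) (Φ u)] at d5
      exact mem_cthickening_of_dist_le u x ρ A hx (by linarith)
    · exact preimage_mono (image_mono hA)
  have hcl : IsClopen (γ ⁻¹' (Φ '' U)) := by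
    constructor
    · rw [e]
      exact ((isClosed_cthickening.isCompact.image_of_continuousOn
        (hcont.mono hA)).isClosed).preimage γ.continuous
    · exact (isOpen_image_of_good hU hΦg).preimage γ.continuous
  have hne : (γ ⁻¹' (Φ '' U)).Nonempty := ⟨_, by rw [mem_preimage, h0]; exact ⟨x, hxU, rfl⟩⟩
  have hpc : PreconnectedSpace ↥(Icc (0:ℝ) 1) := Subtype.preconnectedSpace isPreconnected_Icc
  have := hcl.eq_univ hne
  have h2 : (⟨1, Set.right_mem_Icc.2 zero_le_one⟩ : ↥(Icc (0:ℝ) 1)) ∈ γ ⁻¹' (Φ '' U) := by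
    rw [this]; trivial
  rwa [mem_preimage, h1] at h2

lemma deform [CompactSpace X] (hL : LipschitzDeformationPrinciple X) {W C : Set X}
    (hW : IsOpen W) (hC : IsClosed C) (hCW : C ⊆ W) {η : ℝ} (hη : 0 < η) :
    ∃ ε > 0, ∀ h : X → X, InjOn h W → (∀ x ∈ W, GoodAt h x) → (∀ x ∈ W, dist (h x) x < ε) →
      ∃ k : X → X, Function.Injective k ∧ (∀ x, GoodAt k x) ∧ (∀ x ∈ C, k x = h x) ∧
        (∀ x, x ∉ W → k x = x) ∧ ∀ x, dist (k x) x < η := by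
  obtain ⟨N, hN, D, hD1, hD2, hD3⟩ := hL W hW C hC.isCompact hCW
  have hi : IsOpenLipschitzEmbedding (inclCM W : W → X) :=
    isOpenLip_of_good (f := fun x => x) hW (fun x _ y _ h => h) (fun x _ => GoodAt.id x)
      (fun w => rfl)
  have hc := hD1 (inclCM W) ⟨mem_of_mem_nhds hN, hi⟩
  have hb : ball (ContinuousMap.id X) η ∈ 𝓝 (D (inclCM W)) := by
    rw [hD2]; exact ball_mem_nhds _ hη
  have := hc hb
  rw [Filter.mem_map, mem_nhdsWithin_iff_exists_mem_nhds_inter] at this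
  obtain ⟨M, hM, hM'⟩ := this
  obtain ⟨E, hE, hEs⟩ := UniformSpace.mem_nhds_iff.1 (inter_mem hM hN)
  obtain ⟨⟨K, ε⟩, ⟨hK, hε⟩, hKE⟩ :=
    (Metric.uniformity_basis_dist (α := X)).compactConvergenceUniformity.mem_iff.1 hE
  refine ⟨ε, hε, fun h h1 h2 h3 => ?_⟩
  let H : C(W, X) := ⟨fun w => h w, by
    rw [continuous_iff_continuousAt]
    intro w
    exact (h2 w w.2).continuousAt.comp continuous_subtype_val.continuousAt⟩
  have hH : IsOpenLipschitzEmbedding (H : W → X) := isOpenLip_of_good hW h1 h2 (fun w => rfl)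
  have hHM : H ∈ M ∩ N := by
    apply hEs
    apply hKE
    intro x _
    change dist (x : X) (h x) < ε
    rw [dist_comm]; exact h3 x x.2
  obtain ⟨hk1, hk2, hk3⟩ := hD3 H hHM.2 hH
  refine ⟨D H, hk1.1.1, goodAt_of_iso hk1, fun x hx => hk2 ⟨x, hCW hx⟩ hx, hk3, fun x => ?_⟩
  have hm : D H ∈ ball (ContinuousMap.id X) η := hM' ⟨hHM.1, hHM.2, hH⟩
  exact (ContinuousMap.dist_apply_le_dist x).trans_lt hm

lemma exists_modulus {P : ℝ → ℝ → Prop}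
    (h : ∀ ε > 0, ∃ δ > 0, ∀ t, 0 < t → t < δ → P ε t) :
    ∃ δ₀ > (0:ℝ), ∃ χ : ℝ → ℝ, IsModulus χ ∧ ∀ t, 0 < t → t < δ₀ → ∃ ε ≤ χ t, P ε t := by
  have h' : ∀ n : ℕ, ∃ δ > 0, δ ≤ (1/2:ℝ)^n ∧ ∀ t, 0 < t → t < δ → P ((1/2:ℝ)^(n+1)) t := by
    intro n
    obtain ⟨δ, hδ, h1⟩ := h ((1/2:ℝ)^(n+1)) (by positivity)
    exact ⟨min δ ((1/2:ℝ)^n), by positivity, min_le_right _ _,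
      fun t ht ht' => h1 t ht (ht'.trans_le (min_le_left _ _))⟩
  choose d hd hd1 hd2 using h'
  let F : ℕ → ℝ → ℝ := fun n t => (1/2:ℝ)^n * min 1 (max t 0 / d n)
  have hF0 : ∀ n t, 0 ≤ F n t := fun n t => by
    have := hd n
    positivity
  have hF1 : ∀ n t, F n t ≤ (1/2:ℝ)^n := fun n t => by
    have : (0:ℝ) ≤ (1/2:ℝ)^n := by positivity
    exact mul_le_of_le_one_right this (min_le_left _ _)
  have hsum : ∀ t, Summable fun n => F n t := fun t =>
    Summable.of_nonneg_of_le (fun n => hF0 n t) (fun n => hF1 n t) summable_geometric_two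
  refine ⟨d 0, hd 0, fun t => ∑' n, F n t, ⟨?_, ?_, ?_, ?_⟩, ?_⟩
  · refine continuous_tsum (u := fun n => (1/2:ℝ)^n) (fun n => ?_) summable_geometric_two ?_
    · simp only [F]; fun_prop
    · intro n t
      rw [Real.norm_of_nonneg (hF0 n t)]; exact hF1 n t
  · intro s t hst
    refine (hsum s).tsum_le_tsum (fun n => ?_) (hsum t)
    have := hd n
    simp only [F]
    gcongr
  · simp [F]
  · intro t; exact tsum_nonneg fun n => hF0 n t
  · intro t ht ht0
    have hex : ∃ n, d n ≤ t := by
      obtain ⟨n, hn⟩ := exists_pow_lt_of_lt_one ht (by norm_num : (1/2:ℝ) < 1)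
      exact ⟨n, (hd1 n).trans hn.le⟩
    classical
    obtain ⟨m, hm, hmin⟩ : ∃ m, d m ≤ t ∧ ∀ k < m, t < d k :=
      ⟨Nat.find hex, Nat.find_spec hex, fun k hk => not_le.1 (Nat.find_min hex hk)⟩
    obtain _ | m := m
    · linarith
    refine ⟨(1/2:ℝ)^(m+1), ?_, hd2 m t ht (hmin m (Nat.lt_succ_self m))⟩
    have e : F (m+1) t = (1/2:ℝ)^(m+1) := by
      have : 1 ≤ max t 0 / d (m+1) := by
        rw [one_le_div (hd _)]; exact hm.trans (le_max_left _ _)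
      simp only [F]
      rw [min_eq_left this, mul_one]
    rw [← e]
    exact (hsum t).le_tsum (m+1) (fun n _ => hF0 n t)

end Helpers

section Main

open Filter

lemma chain {X : Type*} [MetricSpace X] {A O : Set X} (hA : IsClosed A) (hO : IsOpen O)
    (h : A ⊆ O) :
    ∃ V1 V2 V3 : Set X, IsOpen V1 ∧ IsOpen V2 ∧ IsOpen V3 ∧ A ⊆ V1 ∧ closure V1 ⊆ V2 ∧
      closure V2 ⊆ V3 ∧ closure V3 ⊆ O := by
  obtain ⟨V1, h1, h2, h3⟩ := normal_exists_closure_subset hA hO h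
  obtain ⟨V2, h4, h5, h6⟩ := normal_exists_closure_subset isClosed_closure hO h3
  obtain ⟨V3, h7, h8, h9⟩ := normal_exists_closure_subset isClosed_closure hO h6
  exact ⟨V1, V2, V3, h1, h4, h7, h2, h5, h8, h9⟩

lemma thick {X : Type*} [MetricSpace X] [CompactSpace X] {A O : Set X} (hO : IsOpen O)
    (h : closure A ⊆ O) : ∃ ρ > 0, cthickening ρ (closure A) ⊆ O :=
  isClosed_closure.isCompact.exists_cthickening_subset_open hO h

/-- The inductive claim. -/
def Claim {X : Type u} [MetricSpace X] {ι : Type} (U : ι → Set X) (χ₀ : ℝ → ℝ) (O : Set X) :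
    Prop :=
  ∀ V : Set X, IsOpen V → closure V ⊆ O → ∀ ε > (0:ℝ), ∃ δ₁ > (0:ℝ), ∀ δ, 0 < δ → δ < δ₁ →
    ∀ (Y : Type u) [MetricSpace Y] (θ : X → Y) (Φ : ι → X → Y), Sit U χ₀ δ Y θ Φ →
      ∃ f : X → Y, InjOn f V ∧ (∀ x ∈ V, GoodAt f x) ∧ ∀ x ∈ V, dist (f x) (θ x) < ε

lemma claim_step {X : Type u} [MetricSpace X] [CompactSpace X] [Nonempty X]
    (hL : LipschitzDeformationPrinciple X)
    {ι : Type} (U : ι → Set X) (hUo : ∀ i, IsOpen (U i))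
    (χ₀ : ℝ → ℝ) (hχ₀ : IsModulus χ₀) (O : Set X) (hO : IsOpen O) (a : ι)
    (ih : Claim U χ₀ O) : Claim U χ₀ (O ∪ U a) := by
  intro V hV hVO ε hε
  obtain ⟨V1, V2, V3, hV1, hV2, hV3, hAV, hV12, hV23, hV3O⟩ :=
    chain (A := closure V \ U a) (O := O)
      (isClosed_closure.sdiff (hUo a)) hO (by
        rintro x ⟨hx, hx'⟩
        exact (hVO hx).resolve_right hx')
  obtain ⟨U1, U2, U3, hU1, hU2, hU3, hAU, hU12, hU23, hU3O⟩ :=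
    chain (A := closure V \ V1) (O := U a)
      (isClosed_closure.sdiff hV1) (hUo a) (by
        rintro x ⟨hx, hx'⟩
        by_contra hxa
        exact hx' (hAV ⟨hx, hxa⟩))
  have hcov : ∀ x ∈ V, x ∈ V1 ∨ x ∈ U1 := by
    intro x hx
    by_cases h : x ∈ V1
    · exact Or.inl h
    · exact Or.inr (hAU ⟨subset_closure hx, h⟩)
  obtain ⟨ρ, hρ, hρU⟩ := thick (hUo a) hU3O
  obtain ⟨r1, hr1, hr1V⟩ := thick hV2 hV12
  obtain ⟨r2, hr2, hr2U⟩ := thick hU2 hU12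
  have hV1s : V1 ⊆ V2 := subset_closure.trans hV12
  have hU1s : U1 ⊆ U2 := subset_closure.trans hU12
  have hV2s : V2 ⊆ V3 := subset_closure.trans hV23
  have hU2s : U2 ⊆ U3 := subset_closure.trans hU23
  have hU3s : U3 ⊆ U a := subset_closure.trans hU3O
  set r := min r1 r2 with hr
  have hr0 : 0 < r := lt_min hr1 hr2
  set η := min (ε / 2) (r / 3) with hη
  have hη0 : 0 < η := by positivity
  have hη1 : η ≤ ε / 2 := min_le_left _ _
  have hη2 : η ≤ r / 3 := min_le_right _ _
  obtain ⟨ε₁, hε₁, hdef⟩ := deform hL (W := V3 ∩ U3) (C := closure V2 ∩ closure U2)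
    (hV3.inter hU3) (isClosed_closure.inter isClosed_closure) (inter_subset_inter hV23 hU23) hη0
  obtain ⟨τ, hτ, hχτ⟩ : ∃ τ > 0, χ₀ τ < ρ / 2 := by
    have : Tendsto χ₀ (𝓝 0) (𝓝 0) := by
      have := hχ₀.1.tendsto 0
      rwa [hχ₀.2.2.1] at this
    have h2 := this.eventually (gt_mem_nhds (by positivity : (0:ℝ) < ρ / 2))
    obtain ⟨s, hs, h3⟩ := Metric.eventually_nhds_iff.1 h2
    refine ⟨s / 2, by positivity, h3 ?_⟩
    rw [Real.dist_eq, sub_zero, abs_of_pos (by positivity)]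
    linarith
  set e' := min (min ε (τ / 2)) (min (ε₁ / 2) (r / 3)) with he'
  have he0 : 0 < e' := by positivity
  have he1 : e' ≤ ε := (min_le_left _ _).trans (min_le_left _ _)
  have he2 : e' ≤ τ / 2 := (min_le_left _ _).trans (min_le_right _ _)
  have he3 : e' ≤ ε₁ / 2 := (min_le_right _ _).trans (min_le_left _ _)
  have he4 : e' ≤ r / 3 := (min_le_right _ _).trans (min_le_right _ _)
  obtain ⟨δ₁, hδ₁, hih⟩ := ih V3 hV3 hV3O e' he0
  refine ⟨min δ₁ (min (min (τ / 2) (ρ / 6)) (min (min (ε₁ / 4) (ε / 4)) (r / 9))),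
    by positivity, ?_⟩
  intro δ hδ hδlt Y _ θ Φ hS
  simp only [lt_min_iff] at hδlt
  obtain ⟨hd1, ⟨hd2, hd3⟩, ⟨hd4, hd5⟩, hd6⟩ := hδlt
  obtain ⟨f, hfi, hfg, hfd⟩ := hih δ hδ hd1 Y θ Φ hS
  obtain ⟨hY, hθ, hΦi, hΦg, hΦd⟩ := hS
  -- the transition map
  have hmem : ∀ x ∈ V3 ∩ U3, f x ∈ Φ a '' U a := by
    rintro x ⟨hxV, hxU⟩
    refine curve_mem hY hθ (hUo a) (hΦg a) (hΦd a) hρU (subset_closure hxU) (hU3s hxU) ?_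
    have d1 := hfd x hxV
    have d2 := hΦd a x (hU3s hxU)
    have d3 := dist_triangle_right (Φ a x) (f x) (θ x)
    have d4 : χ₀ (dist (Φ a x) (f x)) ≤ χ₀ τ := hχ₀.2.1 (by linarith)
    linarith
  let Ψ : Y → X := Function.invFunOn (Φ a) (U a)
  have hΨ : ∀ u ∈ U a, Ψ (Φ a u) = u := fun u hu => (hΦi a).leftInvOn_invFunOn hu
  have hh : ∀ x ∈ V3 ∩ U3, Ψ (f x) ∈ U a ∧ Φ a (Ψ (f x)) = f x := by
    intro x hx
    obtain ⟨u, hu, hux⟩ := hmem x hx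
    rw [← hux, hΨ u hu]
    exact ⟨hu, rfl⟩
  obtain ⟨k, hki, hkg, hkC, hkW, hkd⟩ := hdef (fun x => Ψ (f x)) (by
      intro x hx y hy hxy
      have : f x = f y := by
        rw [← (hh x hx).2, ← (hh y hy).2]; exact congrArg _ hxy
      exact hfi hx.1 hy.1 this) (by
      intro x hx
      have h1 : GoodAt Ψ (f x) := by
        rw [← (hh x hx).2]
        exact (hΦg a _ (hh x hx).1).inv (hUo a) (hh x hx).1 hΨ
      exact h1.comp (hfg x hx.1)) (by
      intro x hx
      obtain ⟨h1, h2⟩ := hh x hx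
      have d1 := dist_lt_of_approx hθ (Ψ (f x)) x
      have d2 := hΦd a _ h1
      rw [h2] at d2
      have d3 := hfd x hx.1
      have d4 := dist_triangle_left (θ (Ψ (f x))) (θ x) (f x)
      change dist (Ψ (f x)) x < ε₁
      linarith)
  have hkU : ∀ u ∈ U a, k u ∈ U a := by
    intro u hu
    by_contra hn
    have h1 : k (k u) = k u := hkW _ fun hw => hn (hU3s hw.2)
    rw [hki h1] at hn
    exact hn hu
  have hagree : ∀ x ∈ closure V2 ∩ closure U2, Φ a (k x) = f x := by
    intro x hx
    rw [hkC x hx]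
    exact (hh x ⟨hV23 hx.1, hU23 hx.2⟩).2
  classical
  let F : X → Y := fun x => if x ∈ V1 then f x else Φ a (k x)
  have hF1 : ∀ x ∈ V1, F x = f x := fun x hx => if_pos hx
  have hF2 : ∀ x ∈ U1, F x = Φ a (k x) := by
    intro x hx
    by_cases h : x ∈ V1
    · rw [hF1 x h]
      exact (hagree x ⟨subset_closure (hV1s h), subset_closure (hU1s hx)⟩).symm
    · exact if_neg h
  have hU1a : U1 ⊆ U a := hU1s.trans (hU2s.trans hU3s)
  have hV13 : V1 ⊆ V3 := hV1s.trans hV2s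
  have hkθ : ∀ x ∈ U1, dist (Φ a (k x)) (θ x) < 2 * δ + η := by
    intro x hx
    have d1 := hΦd a _ (hkU x (hU1a hx))
    have d2 := dist_lt_of_approx' hθ (k x) x
    have d3 := hkd x
    have d4 := dist_triangle (Φ a (k x)) (θ (k x)) (θ x)
    linarith
  have hmix : ∀ x ∈ V1, ∀ y ∈ U1, F x = F y → x = y := by
    intro x hx y hy hxy
    rw [hF1 x hx, hF2 y hy] at hxy
    have d1 := dist_lt_of_approx hθ x y
    have d2 := hfd x (hV13 hx)
    have d3 := hkθ y hy
    rw [← hxy] at d3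
    have d4 := dist_triangle_left (θ x) (θ y) (f x)
    have d5 : dist x y ≤ r := by linarith
    have hyV : y ∈ V2 := hr1V (mem_cthickening_of_dist_le y x r1 _ (subset_closure hx)
      (by rw [dist_comm]; exact d5.trans (min_le_left _ _)))
    have hxU : x ∈ U2 := hr2U (mem_cthickening_of_dist_le x y r2 _ (subset_closure hy)
      (d5.trans (min_le_right _ _)))
    have hfy := hagree y ⟨subset_closure hyV, subset_closure (hU1s hy)⟩
    exact hfi (hV13 hx) (hV2s hyV) (hxy.trans hfy)
  refine ⟨F, ?_, ?_, ?_⟩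
  · intro x hx y hy hxy
    rcases hcov x hx with h1 | h1 <;> rcases hcov y hy with h2 | h2
    · rw [hF1 x h1, hF1 y h2] at hxy
      exact hfi (hV13 h1) (hV13 h2) hxy
    · exact hmix x h1 y h2 hxy
    · exact (hmix y h2 x h1 hxy.symm).symm
    · rw [hF2 x h1, hF2 y h2] at hxy
      exact hki (hΦi a (hkU x (hU1a h1)) (hkU y (hU1a h2)) hxy)
  · intro x hx
    rcases hcov x hx with h1 | h1
    · refine (hfg x (hV13 h1)).congr ?_
      filter_upwards [hV1.mem_nhds h1] with y hy using (hF1 y hy).symm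
    · refine (GoodAt.comp (hΦg a (k x) (hkU x (hU1a h1))) (hkg x)).congr ?_
      filter_upwards [hU1.mem_nhds h1] with y hy using (hF2 y hy).symm
  · intro x hx
    rcases hcov x hx with h1 | h1
    · rw [hF1 x h1]
      exact (hfd x (hV13 h1)).trans_le he1
    · rw [hF2 x h1]
      have := hkθ x h1
      linarith

lemma claim_all {X : Type u} [MetricSpace X] [CompactSpace X] [Nonempty X]
    (hL : LipschitzDeformationPrinciple X)
    {ι : Type} (U : ι → Set X) (hUo : ∀ i, IsOpen (U i))
    (χ₀ : ℝ → ℝ) (hχ₀ : IsModulus χ₀) (s : Finset ι) : Claim U χ₀ (⋃ i ∈ s, U i) := by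
  classical
  induction s using Finset.induction_on with
  | empty =>
    intro V hV hVO ε hε
    have : V = ∅ := by
      have h := subset_closure.trans hVO
      simpa using h
    subst this
    refine ⟨1, one_pos, fun δ _ _ Y _ θ Φ _ => ⟨θ, ?_, ?_, ?_⟩⟩ <;> simp
  | insert a s ha ih =>
    rw [Finset.set_biUnion_insert, union_comm]
    exact claim_step hL U hUo χ₀ hχ₀ _ (isOpen_biUnion fun i _ => hUo i) a ih

lemma preconnected_of_chi {Y : Type u} [MetricSpace Y] {χ₀ : ℝ → ℝ} (h : IsChiConnected χ₀ Y) :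
    PreconnectedSpace Y := by
  refine ⟨isPreconnected_of_forall_pair ?_⟩
  intro x _ y _
  obtain ⟨γ, h0, h1, -⟩ := h x y
  have hpc : PreconnectedSpace ↥(Icc (0:ℝ) 1) := Subtype.preconnectedSpace isPreconnected_Icc
  exact ⟨range γ, subset_univ _, ⟨_, h0⟩, ⟨_, h1⟩, isPreconnected_range γ.continuous⟩

end Main

/-- **Lipschitz gluing theorem** (Theorem 1.3).  Let `X` be a compact, locally connected
metric space satisfying `L(X)`, covered by finitely many open sets `{U i}`.  Given a modulus
`χ₀` there are `δ₀ > 0` and a modulus `χ` such that: for every `0 < δ < δ₀`, every compact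
`χ₀`-connected metric space `Y` covered by open sets `{Ũ i}`, every `δ`-approximation
`θ : X → Y` and Lipschitz isomorphisms `φ i : U i → Ũ i` that are `δ`-close to `θ`, there is a
bi-Lipschitz homeomorphism `θ' : X → Y` that is `χ(δ)`-close to `θ`. -/
theorem lipschitz_gluing
    {X : Type u} [MetricSpace X] [CompactSpace X] [LocallyConnectedSpace X]
    (hL : LipschitzDeformationPrinciple X)
    {ι : Type} [Finite ι] (U : ι → Set X) (hUo : ∀ i, IsOpen (U i))
    (hUcov : ∀ x : X, ∃ i, x ∈ U i)
    (χ₀ : ℝ → ℝ) (hχ₀ : IsModulus χ₀) :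
    ∃ δ₀ > (0:ℝ), ∃ χ : ℝ → ℝ, IsModulus χ ∧
      ∀ δ : ℝ, 0 < δ → δ < δ₀ →
        ∀ (Y : Type u) [MetricSpace Y] [CompactSpace Y], IsChiConnected χ₀ Y →
          ∀ (Ut : ι → Set Y), (∀ i, IsOpen (Ut i)) → (∀ z : Y, ∃ i, z ∈ Ut i) →
            ∀ θ : X → Y, IsDeltaApprox δ θ →
              ∀ φ : (i : ι) → ↥(U i) → ↥(Ut i),
                (∀ i, IsLipschitzIso (φ i)) →
                (∀ i (x : ↥(U i)), dist ((φ i x : Y)) (θ (x : X)) < δ) →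
                ∃ θ' : X → Y, IsBiLipschitzHomeo θ' ∧ ∀ x : X, dist (θ' x) (θ x) ≤ χ δ := by
  rcases isEmpty_or_nonempty X with hX | hX
  · refine ⟨1, one_pos, fun _ => 0, ⟨continuous_const, monotone_const, rfl, fun _ => le_rfl⟩, ?_⟩
    intro δ _ _ Y _ _ _ Ut _ _ θ hθ φ _ _
    refine ⟨θ, ⟨⟨fun x => hX.elim x, fun z => ?_⟩, 0, fun x => hX.elim x, fun x => hX.elim x⟩,
      fun x => hX.elim x⟩
    obtain ⟨x, -⟩ := hθ.2 z
    exact hX.elim x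
  have := Fintype.ofFinite ι
  have hcl : Claim U χ₀ univ := by
    have h := claim_all hL U hUo χ₀ hχ₀ Finset.univ
    have e : (⋃ i ∈ (Finset.univ : Finset ι), U i) = univ := by
      ext x
      simpa using hUcov x
    rwa [e] at h
  obtain ⟨δ₀, hδ₀, χ, hχ, H⟩ := exists_modulus (P := fun ε δ =>
    ∀ (Y : Type u) [MetricSpace Y] (θ : X → Y) (Φ : ι → X → Y), Sit U χ₀ δ Y θ Φ →
      ∃ f : X → Y, InjOn f univ ∧ (∀ x ∈ univ, GoodAt f x) ∧ ∀ x ∈ univ, dist (f x) (θ x) < ε)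
    (hcl univ isOpen_univ (subset_univ _))
  refine ⟨δ₀, hδ₀, χ, hχ, ?_⟩
  intro δ hδ hδ' Y _ _ hY Ut hUt _ θ hθ φ hφ hφd
  obtain ⟨ε, hε, hP⟩ := H δ hδ hδ'
  classical
  let Φ : ι → X → Y := fun i x => if h : x ∈ U i then (φ i ⟨x, h⟩ : Y) else θ x
  have hΦ : ∀ i (u : U i), Φ i u = φ i u := by
    rintro i ⟨u, hu⟩
    exact dif_pos hu
  have hS : Sit U χ₀ δ Y θ Φ := by
    refine ⟨hY, hθ.1, ?_, ?_, ?_⟩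
    · intro i x hx y hy hxy
      have h1 := hΦ i ⟨x, hx⟩
      have h2 := hΦ i ⟨y, hy⟩
      have h3 : φ i ⟨x, hx⟩ = φ i ⟨y, hy⟩ := Subtype.ext (by rw [← h1, ← h2]; exact hxy)
      exact congrArg Subtype.val ((hφ i).1.1 h3)
    · intro i x hx
      exact goodAt_extend (hUo i) (hUt i) (hφ i) (hΦ i) ⟨x, hx⟩
    · intro i x hx
      have h1 := hΦ i ⟨x, hx⟩
      have h2 := hφd i ⟨x, hx⟩
      rw [← h1] at h2
      exact h2
  obtain ⟨f, hfi, hfg, hfd⟩ := hP Y θ Φ hS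
  have := preconnected_of_chi hY
  exact ⟨f, biLip_of_good (injOn_univ.1 hfi) (fun x => hfg x (mem_univ x)),
    fun x => (hfd x (mem_univ x)).le.trans hε⟩
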